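/- arXiv:1608.08957 — 2 statements merged into one kernel-verified Lean document; each statement's English description precedes it below -/
import Mathlib

section
/- Let G be a finite connected simple graph that is k-regular and let u ∈ (0, 1/2]. Then B_u(G) ≥ (h_u(G)/(k + h_u(G)))·|V(G)|. -/
open SimpleGraph Finset

namespace GraphGonality

variable {V : Type*}

/-- The degree of a divisor: the sum of its values. -/
def degD [Fintype V] (D : V → ℤ) : ℤ := ∑ v, D v

/-- A divisor is effective if it is nonnegative at every vertex. -/
def Effective (D : V → ℤ) : Prop := ∀ v, 0 ≤ D v

/-- The graph Laplacian applied to an integer vector. -/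
def lapply (G : SimpleGraph V) [Fintype V] [DecidableEq V] [DecidableRel G.Adj]
    (x : V → ℤ) : V → ℤ :=
  fun v => (G.degree v : ℤ) * x v - ∑ w ∈ G.neighborFinset v, x w

/-- Two divisors are linearly equivalent if their difference lies in the image of the
Laplacian acting on `ℤ^V`. -/
def LinEquiv (G : SimpleGraph V) [Fintype V] [DecidableEq V] [DecidableRel G.Adj]
    (D D' : V → ℤ) : Prop :=
  ∃ x : V → ℤ, D - D' = lapply G x

/-- A divisor has positive rank if, for every vertex `v`, the divisor `D - 1_v` is
linearly equivalent to an effective divisor. -/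
def PosRank (G : SimpleGraph V) [Fintype V] [DecidableEq V] [DecidableRel G.Adj]
    (D : V → ℤ) : Prop :=
  ∀ v : V, ∃ E : V → ℤ, Effective E ∧
    LinEquiv G (fun w => D w - if w = v then 1 else 0) E

/-- The gonality of a graph: the smallest degree of a divisor of positive rank. -/
noncomputable def gonality (G : SimpleGraph V) [Fintype V] [DecidableEq V]
    [DecidableRel G.Adj] : ℤ :=
  sInf {d : ℤ | ∃ D : V → ℤ, PosRank G D ∧ degD D = d}

/-- The support of a divisor. -/
def suppD (D : V → ℤ) : Set V := {v | 0 < D v}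

/-- The edge boundary of a set of vertices: edges with exactly one endpoint in `U`. -/
def edgeBoundary (G : SimpleGraph V) (U : Set V) : Set (Sym2 V) :=
  {e | e ∈ G.edgeSet ∧ ∃ a b, e = s(a, b) ∧ a ∈ U ∧ b ∉ U}

/-- The Cheeger constant of a graph. -/
noncomputable def cheeger (G : SimpleGraph V) [Fintype V] : ℝ :=
  sInf {r : ℝ | ∃ U : Set V, U.Nonempty ∧ (U.ncard : ℝ) ≤ (Fintype.card V : ℝ) / 2 ∧
    r = (edgeBoundary G U).ncard / U.ncard}

/-- The `u`-Cheeger constant of a graph. -/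
noncomputable def cheegerU (G : SimpleGraph V) [Fintype V] (u : ℝ) : ℝ :=
  sInf {r : ℝ | ∃ U : Set V, U.Nonempty ∧ (U.ncard : ℝ) ≤ u * (Fintype.card V : ℝ) ∧
    r = (edgeBoundary G U).ncard / U.ncard}

/-- Every connected component of the induced subgraph on the complement of the support
of `D` has at most `u * |V|` vertices. -/
def ComponentsSmall (G : SimpleGraph V) [Fintype V] (D : V → ℤ) (u : ℝ) : Prop :=
  ∀ c : (G.induce (suppD D)ᶜ).ConnectedComponent,
    (c.supp.ncard : ℝ) ≤ u * (Fintype.card V : ℝ)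

/-- `B_u(G)`: the smallest degree of an effective divisor all of whose complementary
components have size at most `u * |V|`. -/
noncomputable def Bu (G : SimpleGraph V) [Fintype V] (u : ℝ) : ℤ :=
  sInf {d : ℤ | ∃ D : V → ℤ, Effective D ∧ ComponentsSmall G D u ∧ degD D = d}


/-- The `u`-Cheeger constant is nonnegative. -/
theorem cheegerU_nonneg [Fintype V] (G : SimpleGraph V) (u : ℝ) : 0 ≤ cheegerU G u := by
  refine Real.sInf_nonneg ?_
  rintro r ⟨U, -, -, rfl⟩
  positivity

/-- The edge boundary of a set of at most `u * |V|` vertices is bounded below by the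
`u`-Cheeger constant times the size of the set. -/
theorem cheegerU_mul_ncard_le [Fintype V] (G : SimpleGraph V) {u : ℝ} {U : Set V}
    (hU : (U.ncard : ℝ) ≤ u * (Fintype.card V : ℝ)) :
    cheegerU G u * U.ncard ≤ (edgeBoundary G U).ncard := by
  rcases U.eq_empty_or_nonempty with rfl | hne
  · simp
  · have hpos : (0 : ℝ) < U.ncard := by
      exact_mod_cast (Set.ncard_pos U.toFinite).2 hne
    rw [← le_div_iff₀ hpos]
    refine csInf_le ⟨0, ?_⟩ ⟨U, hne, hU, rfl⟩
    rintro r ⟨U', -, -, rfl⟩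
    positivity

/-- The edge boundary of `U` has at most as many edges as there are pairs of adjacent vertices
in `U × T`, if `T` contains every neighbour of `U` outside of `U`. -/
theorem ncard_edgeBoundary_le [Fintype V] [DecidableEq V] (G : SimpleGraph V)
    [DecidableRel G.Adj] (U T : Finset V)
    (hT : ∀ a ∈ U, ∀ b, b ∉ U → G.Adj a b → b ∈ T) :
    (edgeBoundary G (U : Set V)).ncard ≤ ∑ a ∈ U, #{b ∈ T | G.Adj a b} := by
  have hsub : edgeBoundary G (U : Set V) ⊆
      (U.biUnion fun a => ({b ∈ T | G.Adj a b} : Finset V).image fun b => s(a, b) :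
        Finset (Sym2 V)) := by
    rintro e ⟨he, a, b, rfl, ha, hb⟩
    have hab : G.Adj a b := he
    simp only [Finset.coe_biUnion, Set.mem_iUnion, Finset.coe_image]
    exact ⟨a, ha, b, by simpa using ⟨hT a ha b hb hab, hab⟩, rfl⟩
  calc (edgeBoundary G (U : Set V)).ncard
      ≤ _ := Set.ncard_le_ncard hsub (Finset.finite_toSet _)
    _ = _ := Set.ncard_coe_finset _
    _ ≤ _ := card_biUnion_le
    _ ≤ _ := sum_le_sum fun a _ => card_image_le

/-- In a `k`-regular graph, there are at most `k * |S|` edges leaving `S`. -/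
theorem sum_card_adj_compl_le [Fintype V] [DecidableEq V] (G : SimpleGraph V)
    [DecidableRel G.Adj] {k : ℕ} (hreg : G.IsRegularOfDegree k) (S : Finset V) :
    ∑ a ∈ Sᶜ, #{b ∈ S | G.Adj a b} ≤ k * #S := by
  have h := sum_card_bipartiteAbove_eq_sum_card_bipartiteBelow (s := Sᶜ) (t := S) G.Adj
  simp only [bipartiteAbove, bipartiteBelow] at h
  rw [h, mul_comm, ← smul_eq_mul]
  refine sum_le_card_nsmul _ _ _ fun b _ => ?_
  rw [← hreg b, ← card_neighborFinset_eq_degree]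
  refine card_le_card fun a ha => ?_
  simpa [G.adj_comm] using (mem_filter.1 ha).2

/-- If removing `S` from a `k`-regular graph leaves components of size at most `u * |V|`, then
the `u`-Cheeger constant bounds the number of remaining vertices by the edges leaving `S`. -/
theorem cheegerU_mul_card_compl_le [Fintype V] [DecidableEq V] (G : SimpleGraph V)
    [DecidableRel G.Adj] {k : ℕ} (hreg : G.IsRegularOfDegree k) {u : ℝ} (S : Finset V)
    (hS : ∀ c : (G.induce ((S : Set V)ᶜ)).ConnectedComponent,
      (c.supp.ncard : ℝ) ≤ u * (Fintype.card V : ℝ)) :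
    cheegerU G u * #Sᶜ ≤ k * #S := by
  classical
  let H := G.induce ((S : Set V)ᶜ)
  let comp : H.ConnectedComponent → Finset ((S : Set V)ᶜ : Set V) :=
    fun c => {a | H.connectedComponentMk a = c}
  let emb := Function.Embedding.subtype (· ∈ (S : Set V)ᶜ)
  have hcard (c : H.ConnectedComponent) : #(comp c) = c.supp.ncard := by
    rw [← Set.ncard_coe_finset]
    congr 1
    ext a
    simp [comp, ConnectedComponent.mem_supp_iff]
  have hbound (c : H.ConnectedComponent) : cheegerU G u * #(comp c) ≤
      ∑ a ∈ comp c, (#{b ∈ S | G.Adj a b} : ℝ) := by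
    have h₁ := cheegerU_mul_ncard_le G (U := ((comp c).map emb : Finset V)) (u := u)
      (by rw [Set.ncard_coe_finset, card_map, hcard]; exact hS c)
    have h₂ := ncard_edgeBoundary_le G ((comp c).map emb) S (by
      intro a ha b hb hab
      by_contra hbS
      obtain ⟨a, ha', rfl⟩ := mem_map.1 ha
      refine hb (mem_map.2 ⟨⟨b, by simpa using hbS⟩, ?_, rfl⟩)
      rw [mem_filter_univ, ← (mem_filter.1 ha').2]
      exact ConnectedComponent.connectedComponentMk_eq_of_adj
        (show H.Adj _ _ from hab.symm))
    rw [Set.ncard_coe_finset, card_map] at h₁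
    rw [sum_map] at h₂
    exact h₁.trans (by exact_mod_cast h₂)
  have hsum (f : V → ℕ) : ∑ a ∈ Sᶜ, f a = ∑ c, ∑ a ∈ comp c, f a := by
    exact (sum_subtype _ (by simp) f).trans
      (sum_fiberwise univ H.connectedComponentMk fun a => f a).symm
  have hcompl : #Sᶜ = ∑ c, #(comp c) := by simpa using hsum fun _ => 1
  calc cheegerU G u * #Sᶜ = ∑ c, cheegerU G u * #(comp c) := by
        rw [hcompl, Nat.cast_sum, mul_sum]
    _ ≤ ∑ c, ∑ a ∈ comp c, (#{b ∈ S | G.Adj a b} : ℝ) := sum_le_sum fun c _ => hbound c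
    _ = (∑ a ∈ Sᶜ, #{b ∈ S | G.Adj a b} : ℕ) := by rw [hsum]; push_cast; rfl
    _ ≤ k * #S := by exact_mod_cast sum_card_adj_compl_le G hreg S

/-- The support of an effective divisor has at most `deg D` vertices. -/
theorem Effective.card_support_le [Fintype V] {D : V → ℤ} (hD : Effective D) :
    (#{v | 0 < D v} : ℤ) ≤ degD D := by
  rw [card_filter, Nat.cast_sum]
  refine sum_le_sum fun v _ => ?_
  have := hD v
  split_ifs <;> push_cast <;> omega

/-- The minimum defining `Bu` is attained. -/
theorem exists_degD_eq_Bu [Fintype V] (G : SimpleGraph V) {u : ℝ} :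
    ∃ D : V → ℤ, Effective D ∧ ComponentsSmall G D u ∧ degD D = Bu G u := by
  refine Int.csInf_mem (s := {d : ℤ | ∃ D : V → ℤ, Effective D ∧ ComponentsSmall G D u ∧
    degD D = d}) ⟨_, fun _ => 1, fun _ => zero_le_one, fun c => ?_, rfl⟩ ⟨0, ?_⟩
  · induction c using ConnectedComponent.ind with
    | h v => exact absurd (zero_lt_one' ℤ) v.2
  · rintro d ⟨D, hD, -, rfl⟩
    exact sum_nonneg fun v _ => hD v

/-- For a `k`-regular finite connected simple graph `G` and `u ∈ (0, 1/2]`,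
`B_u(G) ≥ (h_u(G)/(k + h_u(G))) |V(G)|`. -/
theorem Bu_ge_cheegerU {V : Type*} [Fintype V] [DecidableEq V]
    (G : SimpleGraph V) [DecidableRel G.Adj] (hG : G.Connected)
    (k : ℕ) (hreg : G.IsRegularOfDegree k) (u : ℝ) (hu0 : 0 < u) (hu : u ≤ 1 / 2) :
    cheegerU G u / ((k : ℝ) + cheegerU G u) * (Fintype.card V : ℝ) ≤ (Bu G u : ℝ) := by
  obtain ⟨D, hD, hsmall, hdeg⟩ := exists_degD_eq_Bu G (u := u)
  have hsupp : suppD D = (({v | 0 < D v} : Finset V) : Set V) := by simp [suppD]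
  have hle : (#{v | 0 < D v} : ℝ) ≤ Bu G u := by
    rw [← hdeg]
    exact_mod_cast hD.card_support_le
  unfold ComponentsSmall at hsmall
  rw [hsupp] at hsmall
  have hmain := cheegerU_mul_card_compl_le G hreg _ hsmall
  have hh := cheegerU_nonneg G u
  refine le_trans ?_ hle
  rcases (add_nonneg k.cast_nonneg hh).eq_or_lt with h0 | hpos
  · simp [← h0]
  · rw [div_mul_eq_mul_div, div_le_iff₀ hpos]
    rw [card_compl, Nat.cast_sub (card_le_univ _)] at hmain
    linarith

end GraphGonality
end

section
/- Let G be a finite connected simple graph that is 3-regular and satisfies h(G) ≥ 1/4.95 and h_{0.36}(G) ≥ 0.24. Then gon(G) ≥ 0.072·|V(G)|. -/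
open SimpleGraph Finset

namespace GraphGonality

variable {V : Type*}

section Laplacian

variable [Fintype V] [DecidableEq V] (G : SimpleGraph V) [DecidableRel G.Adj]

theorem lapply_eq_sum (x : V → ℤ) (v : V) :
    lapply G x v = ∑ w ∈ G.neighborFinset v, (x v - x w) := by
  simp [lapply, Finset.sum_sub_distrib]

theorem lapply_eq_mulVec (x : V → ℤ) : lapply G x = (G.lapMatrix ℤ).mulVec x := by
  ext v
  simp [lapply, G.lapMatrix_mulVec_apply]

theorem lapply_sub (x y : V → ℤ) : lapply G (x - y) = lapply G x - lapply G y := by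
  simp only [lapply_eq_mulVec, Matrix.mulVec_sub]

theorem lapply_const (c : ℤ) : lapply G (fun _ => c) = 0 := by
  ext v
  simp [lapply_eq_sum]

theorem degD_lapply (x : V → ℤ) : degD (lapply G x) = 0 := by
  have h := Matrix.dotProduct_mulVec (fun _ : V => (1 : ℤ)) (G.lapMatrix ℤ) x
  rw [← Matrix.mulVec_transpose, (G.isSymm_lapMatrix (R := ℤ)).eq,
    G.lapMatrix_mulVec_const_eq_zero, zero_dotProduct, ← lapply_eq_mulVec] at h
  simpa [degD, dotProduct] using h

variable {G}

theorem LinEquiv.degD_eq {D D' : V → ℤ} (h : LinEquiv G D D') : degD D = degD D' := by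
  obtain ⟨x, hx⟩ := h
  have := degD_lapply G x
  rw [← hx] at this
  simpa [degD, Finset.sum_sub_distrib, sub_eq_zero] using this

theorem LinEquiv.of_left {D E E' : V → ℤ} (h : LinEquiv G D E) (h' : LinEquiv G D E') :
    LinEquiv G E E' := by
  obtain ⟨x, hx⟩ := h
  obtain ⟨y, hy⟩ := h'
  refine ⟨y - x, ?_⟩
  rw [lapply_sub, ← hx, ← hy]
  abel

theorem LinEquiv.sub_lapply {D E : V → ℤ} (h : LinEquiv G D E) (y : V → ℤ) :
    LinEquiv G D (E - lapply G y) := by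
  obtain ⟨x, hx⟩ := h
  refine ⟨x - (0 - y), ?_⟩
  rw [lapply_sub, lapply_sub, ← hx, show (0 : V → ℤ) = fun _ => 0 from rfl, lapply_const]
  abel

end Laplacian

theorem cheegerU_half [Fintype V] (G : SimpleGraph V) : cheegerU G (1 / 2) = cheeger G := by
  unfold cheegerU cheeger
  simp only [one_div_mul_eq_div]

theorem card_interedges_comm (G : SimpleGraph V) [DecidableRel G.Adj] (A B : Finset V) :
    #(G.interedges A B) = #(G.interedges B A) :=
  have : Std.Symm G.Adj := ⟨fun _ _ h => h.symm⟩
  Rel.card_interedges_comm A B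

section Cuts

variable [Fintype V] [DecidableEq V] (G : SimpleGraph V) [DecidableRel G.Adj]

theorem card_interedges_eq_sum (A B : Finset V) :
    #(G.interedges A B) = ∑ v ∈ A, #(G.neighborFinset v ∩ B) := by
  rw [interedges_def, Finset.card_filter, Finset.sum_product]
  refine Finset.sum_congr rfl fun v _ => ?_
  rw [← Finset.card_filter]
  congr 1
  ext w
  simp [and_comm]

theorem ncard_edgeBoundary_le_s7 (A : Finset V) :
    (edgeBoundary G (A : Set V)).ncard ≤ #(G.interedges A Aᶜ) := by
  have hsub : edgeBoundary G (A : Set V) ⊆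
      ((G.interedges A Aᶜ).image fun p => s(p.1, p.2) : Finset (Sym2 V)) := by
    rintro e ⟨he, a, b, rfl, ha, hb⟩
    simp only [Finset.coe_image, Set.mem_image]
    exact ⟨(a, b), by simpa [mem_interedges_iff] using ⟨ha, hb, he⟩, rfl⟩
  refine (Set.ncard_le_ncard hsub (Finset.finite_toSet _)).trans ?_
  rw [Set.ncard_coe_finset]
  exact Finset.card_image_le

theorem le_card_interedges_of_le_cheegerU {u h : ℝ} (hu : h ≤ cheegerU G u) {A : Finset V}
    (hne : A.Nonempty) (hA : (#A : ℝ) ≤ u * Fintype.card V) :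
    h * #A ≤ #(G.interedges A Aᶜ) := by
  have hpos : (0 : ℝ) < #A := by exact_mod_cast hne.card_pos
  have hle : h ≤ (edgeBoundary G (A : Set V)).ncard / (A : Set V).ncard := by
    refine hu.trans (csInf_le ⟨0, ?_⟩ ⟨A, by simpa using hne, by simpa using hA, rfl⟩)
    rintro r ⟨U, -, -, rfl⟩
    positivity
  rw [Set.ncard_coe_finset, le_div_iff₀ hpos] at hle
  exact hle.trans (by exact_mod_cast ncard_edgeBoundary_le_s7 G A)

/-- Among sets of at most half of the vertices, and their complements, the edge boundary is
controlled by the Cheeger constant. -/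
theorem le_card_interedges_of_le_cheeger {h c : ℝ} (hh : h ≤ cheeger G) (h0 : 0 ≤ h)
    (hc : 0 ≤ c) {A : Finset V} (hA : c < #A) (hA' : c < #Aᶜ) :
    h * c ≤ #(G.interedges A Aᶜ) := by
  rw [← cheegerU_half] at hh
  have hsum : (#A : ℝ) + #Aᶜ = Fintype.card V := by exact_mod_cast A.card_add_card_compl
  have key : ∀ B : Finset V, c < #B → (#B : ℝ) ≤ 1 / 2 * Fintype.card V →
      h * c ≤ #(G.interedges B Bᶜ) := fun B hB hB' => by
    have hne : B.Nonempty := Finset.card_pos.1 (by exact_mod_cast hc.trans_lt hB)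
    exact (mul_le_mul_of_nonneg_left hB.le h0).trans
      (le_card_interedges_of_le_cheegerU G hh hne hB')
  rcases le_total (#A : ℝ) #Aᶜ with hle | hle
  · exact key A hA (by linarith)
  · have := key Aᶜ hA' (by linarith)
    rwa [compl_compl, card_interedges_comm] at this

/-- A set of more than `c` vertices that has no partition into two nonempty parts without edges
between them. -/
def IsCluster (c : ℝ) (A : Finset V) : Prop :=
  c < #A ∧ ∀ B ⊆ A, B.Nonempty → (A \ B).Nonempty → ∃ v ∈ B, ∃ w ∈ A \ B, G.Adj v w

theorem card_interedges_compl_add_le {A B : Finset V} (hBA : B ⊆ A)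
    (hB : ∀ v ∈ B, ∀ w ∈ A \ B, ¬ G.Adj v w) :
    #(G.interedges B Bᶜ) + #(G.interedges (A \ B) (A \ B)ᶜ) ≤ #(G.interedges A Aᶜ) := by
  have hdisj : Disjoint (G.interedges B Bᶜ) (G.interedges (A \ B) (A \ B)ᶜ) := by
    rw [Finset.disjoint_left]
    intro p hp hp'
    rw [mem_interedges_iff] at hp hp'
    exact (Finset.mem_sdiff.1 hp'.1).2 hp.1
  rw [← Finset.card_union_of_disjoint hdisj]
  refine Finset.card_le_card fun p hp => ?_
  simp only [Finset.mem_union, mem_interedges_iff, Finset.mem_compl, Finset.mem_sdiff,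
    not_and_not_right] at hp ⊢
  rcases hp with ⟨h1, h2, h3⟩ | ⟨h1, h2, h3⟩
  · exact ⟨hBA h1, fun h => hB _ h1 _ (Finset.mem_sdiff.2 ⟨h, h2⟩) h3, h3⟩
  · exact ⟨h1.1, fun h => hB _ (h2 h) _ (Finset.mem_sdiff.2 h1) h3.symm, h3⟩

theorem exists_isCluster_subset {c h : ℝ}
    (hh : ∀ U : Finset V, U.Nonempty → (#U : ℝ) ≤ c → h * #U ≤ #(G.interedges U Uᶜ))
    (A : Finset V) (hA : (#(G.interedges A Aᶜ) : ℝ) < h * #A) :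
    ∃ C ⊆ A, IsCluster G c C := by
  induction A using Finset.strongInduction with
  | H A ih =>
    have hne : A.Nonempty := by
      rw [Finset.nonempty_iff_ne_empty]
      rintro rfl
      simp at hA
    have hlarge : c < #A := by
      by_contra! hle
      exact (hh A hne hle).not_gt hA
    by_cases hcl : ∀ B ⊆ A, B.Nonempty → (A \ B).Nonempty → ∃ v ∈ B, ∃ w ∈ A \ B, G.Adj v w
    · exact ⟨A, subset_rfl, hlarge, hcl⟩
    push Not at hcl
    obtain ⟨B, hBA, hB, hAB, hno⟩ := hcl
    have hcut : (#(G.interedges B Bᶜ) : ℝ) + #(G.interedges (A \ B) (A \ B)ᶜ) ≤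
        #(G.interedges A Aᶜ) := by exact_mod_cast card_interedges_compl_add_le G hBA hno
    have hcard : (#(A \ B) : ℝ) + #B = #A := by
      exact_mod_cast Finset.card_sdiff_add_card_eq_card hBA
    rcases lt_or_ge (#(G.interedges B Bᶜ) : ℝ) (h * #B) with hlt | hge
    · have hss : B ⊂ A := Finset.ssubset_iff_subset_ne.2 ⟨hBA, by rintro rfl; simp at hAB⟩
      obtain ⟨C, hC, hC'⟩ := ih B hss hlt
      exact ⟨C, hC.trans hBA, hC'⟩
    · have hss : A \ B ⊂ A := Finset.sdiff_ssubset hBA hB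
      obtain ⟨C, hC, hC'⟩ := ih (A \ B) hss (by rw [← hcard] at hA; linarith)
      exact ⟨C, hC.trans Finset.sdiff_subset, hC'⟩

theorem card_interedges_le_of_isRegular {k : ℕ} (hreg : G.IsRegularOfDegree k) (A B : Finset V) :
    #(G.interedges A B) ≤ k * #A := by
  rw [card_interedges_eq_sum, mul_comm, ← smul_eq_mul]
  refine Finset.sum_le_card_nsmul _ _ _ fun v _ => ?_
  rw [← hreg.degree_eq v]
  exact Finset.card_le_card Finset.inter_subset_left

/-- A divisor of small degree on a regular expander misses a cluster. -/
theorem exists_isCluster_eq_zero {c h : ℝ} {k : ℕ} (hreg : G.IsRegularOfDegree k)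
    (hh : ∀ U : Finset V, U.Nonempty → (#U : ℝ) ≤ c → h * #U ≤ #(G.interedges U Uᶜ))
    (h0 : 0 ≤ h) {D : V → ℤ} (hD : Effective D)
    (hdeg : (k + h) * (degD D : ℝ) < h * Fintype.card V) :
    ∃ C, IsCluster G c C ∧ ∀ v ∈ C, D v = 0 := by
  let S : Finset V := {v | D v ≠ 0}
  have hS : (#S : ℤ) ≤ degD D := by
    rw [Finset.card_eq_sum_ones, degD]
    push_cast
    refine (Finset.sum_le_sum fun v hv => ?_).trans
      (Finset.sum_le_sum_of_subset_of_nonneg (Finset.subset_univ S) fun v _ _ => hD v)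
    have := hD v
    have : D v ≠ 0 := by simpa [S] using hv
    lia
  have hS' : (#S : ℝ) ≤ degD D := by exact_mod_cast hS
  have hcut : (#(G.interedges Sᶜ Sᶜᶜ) : ℝ) ≤ k * #S := by
    rw [compl_compl, card_interedges_comm]
    exact_mod_cast card_interedges_le_of_isRegular G hreg S Sᶜ
  have hsum : (#S : ℝ) + #Sᶜ = Fintype.card V := by exact_mod_cast S.card_add_card_compl
  obtain ⟨C, hC, hC'⟩ := exists_isCluster_subset G hh Sᶜ (by
    have : (k + h) * (#S : ℝ) ≤ (k + h) * degD D := by gcongr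
    rw [← hsum] at hdeg
    linarith)
  exact ⟨C, hC', fun v hv => by simpa [S] using hC hv⟩

end Cuts

section Firing

variable [Fintype V] [DecidableEq V] {G : SimpleGraph V} [DecidableRel G.Adj]

theorem lapply_indicator_of_mem {U : Finset V} {v : V} (hv : v ∈ U) :
    lapply G (fun w => if w ∈ U then 1 else 0) v = #(G.neighborFinset v ∩ Uᶜ) := by
  rw [lapply_eq_sum, ← Finset.sdiff_eq_inter_compl, Finset.sdiff_eq_filter, Finset.card_filter]
  push_cast
  refine Finset.sum_congr rfl fun w _ => ?_
  by_cases hw : w ∈ U <;> simp [hv, hw]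

theorem lapply_indicator_of_notMem {U : Finset V} {v : V} (hv : v ∉ U) :
    lapply G (fun w => if w ∈ U then 1 else 0) v ≤ 0 := by
  rw [lapply_eq_sum]
  refine Finset.sum_nonpos fun w _ => ?_
  by_cases hw : w ∈ U <;> simp [hv, hw]

variable {D D' : V → ℤ} {U : Finset V}

/-- If firing `U` keeps a divisor effective, then its degree is at least the edge boundary
of `U`. -/
theorem card_interedges_le_degD (hD : Effective D) (hD' : Effective D')
    (hU : D - D' = lapply G fun w => if w ∈ U then 1 else 0) :
    (#(G.interedges U Uᶜ) : ℤ) ≤ degD D := by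
  rw [card_interedges_eq_sum, degD]
  push_cast
  refine (Finset.sum_le_sum fun v hv => ?_).trans
    (Finset.sum_le_sum_of_subset_of_nonneg (Finset.subset_univ U) fun v _ _ => hD v)
  rw [← lapply_indicator_of_mem hv, ← hU, Pi.sub_apply]
  have := hD' v
  lia

/-- A cluster without chips lies on one side of a fired set; if the side outside is too small to
contain it, it does not receive chips. -/
theorem IsCluster.eq_zero_of_fire {c : ℝ} {C : Finset V} (hC : IsCluster G c C)
    (hD' : Effective D')
    (hU : D - D' = lapply G fun w => if w ∈ U then 1 else 0) (hUc : (#Uᶜ : ℝ) ≤ c)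
    (h0 : ∀ v ∈ C, D v = 0) : ∀ v ∈ C, D' v = 0 := by
  have hval : ∀ v, D v - D' v = lapply G (fun w => if w ∈ U then 1 else 0) v := fun v => by
    rw [← hU, Pi.sub_apply]
  have hinter : (C ∩ U).Nonempty := by
    by_contra hempty
    rw [Finset.not_nonempty_iff_eq_empty, ← Finset.disjoint_iff_inter_eq_empty] at hempty
    have : #C ≤ #Uᶜ := Finset.card_le_card (Finset.subset_compl_iff_disjoint_right.2 hempty)
    have : (#C : ℝ) ≤ #Uᶜ := by exact_mod_cast this
    linarith [hC.1]
  have hsub : C ⊆ U := by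
    by_contra hnot
    obtain ⟨v, hv, w, hw, hvw⟩ := hC.2 (C ∩ U) Finset.inter_subset_left hinter
      (by rwa [Finset.sdiff_inter_self_left, Finset.sdiff_nonempty])
    rw [Finset.mem_inter] at hv
    have hpos : 0 < #(G.neighborFinset v ∩ Uᶜ) :=
      Finset.card_pos.2 ⟨w, by simp_all⟩
    have h1 := hval v
    rw [lapply_indicator_of_mem hv.2, h0 v hv.1] at h1
    have := hD' v
    lia
  intro v hv
  have h1 := hval v
  rw [lapply_indicator_of_mem (hsub hv), h0 v hv] at h1
  have := hD' v
  lia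

/-- Truncating a firing script keeps the divisor effective. -/
theorem effective_sub_lapply_max (hD : Effective D) {f : V → ℤ}
    (hf : Effective (D - lapply G f)) (t : ℤ) :
    Effective (D - lapply G fun v => max (f v) t) := by
  intro v
  rw [Pi.sub_apply, lapply_eq_sum]
  rcases le_total t (f v) with h | h
  · have hv := hf v
    rw [Pi.sub_apply, lapply_eq_sum] at hv
    have : ∑ w ∈ G.neighborFinset v, (max (f v) t - max (f w) t) ≤
        ∑ w ∈ G.neighborFinset v, (f v - f w) :=
      Finset.sum_le_sum fun w _ => by lia
    lia
  · have := hD v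
    have : ∑ w ∈ G.neighborFinset v, (max (f v) t - max (f w) t) ≤ 0 :=
      Finset.sum_nonpos fun w _ => by lia
    lia

theorem lapply_max_sub_lapply_max (f : V → ℤ) (t : ℤ) :
    (D - lapply G fun v => max (f v) (t + 1)) - (D - lapply G fun v => max (f v) t) =
      lapply G fun w => if w ∈ ({v | f v ≤ t} : Finset V)ᶜ then 1 else 0 := by
  rw [sub_sub_sub_cancel_left]
  have : (fun w => if w ∈ ({v | f v ≤ t} : Finset V)ᶜ then (1 : ℤ) else 0) =
      ((fun v => max (f v) t) - fun v => max (f v) (t + 1)) - fun _ => -1 := by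
    ext w
    by_cases hw : f w ≤ t <;> simp [hw] <;> lia
  rw [this, lapply_sub, lapply_const, sub_zero, lapply_sub]

end Firing

section PositiveRank

variable [Fintype V] [DecidableEq V] {G : SimpleGraph V} [DecidableRel G.Adj]

theorem PosRank.exists_effective {D : V → ℤ} (hD : PosRank G D) (v : V) :
    ∃ E, Effective E ∧ LinEquiv G D E ∧ E v ≠ 0 := by
  obtain ⟨E, hE, x, hx⟩ := hD v
  refine ⟨fun w => E w + if w = v then 1 else 0, fun w => ?_, ⟨x, ?_⟩, ?_⟩
  · have := hE w
    by_cases h : w = v <;> simp [h] <;> lia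
  · rw [← hx]
    ext w
    simp only [Pi.sub_apply]
    ring
  · have := hE v
    simp
    lia

/-- Let `D` have positive rank and suppose that every edge cut with more than `c` vertices on both
sides has more than `degD D` edges. Then some effective divisor equivalent to `D` meets every
cluster of more than `c` vertices. -/
theorem PosRank.exists_effective_hitting {D : V → ℤ} (hD : PosRank G D) [Nonempty V] {c : ℝ}
    (hc : 0 ≤ c) (hcut : ∀ A : Finset V, c < #A → c < #Aᶜ → degD D < #(G.interedges A Aᶜ)) :
    ∃ E, Effective E ∧ LinEquiv G D E ∧ ∀ C, IsCluster G c C → ∃ v ∈ C, E v ≠ 0 := by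
  let missed : (V → ℤ) → Set (Finset V) := fun E => {C | IsCluster G c C ∧ ∀ v ∈ C, E v = 0}
  obtain ⟨E, ⟨hE, hDE⟩, hmin⟩ : ∃ E, (Effective E ∧ LinEquiv G D E) ∧
      ∀ E', Effective E' ∧ LinEquiv G D E' → missed E' ⊆ missed E → missed E ⊆ missed E' := by
    obtain ⟨E₁, h₁, h₁', -⟩ := hD.exists_effective (Classical.arbitrary V)
    obtain ⟨-, ⟨E, hE, rfl⟩, hm⟩ := (Set.toFinite
      (missed '' {E | Effective E ∧ LinEquiv G D E})).exists_minimal ⟨_, E₁, ⟨h₁, h₁'⟩, rfl⟩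
    exact ⟨E, hE, fun E' hE' hle => hm ⟨E', hE', rfl⟩ hle⟩
  refine ⟨E, hE, hDE, ?_⟩
  by_contra! hmiss
  obtain ⟨C, hC, hC0⟩ := hmiss
  have hCne : C.Nonempty := Finset.card_pos.1 (by exact_mod_cast hc.trans_lt hC.1)
  obtain ⟨v, hv⟩ := hCne
  obtain ⟨E', hE', hDE', hvE'⟩ := hD.exists_effective v
  obtain ⟨f, hf⟩ := hDE.of_left hDE'
  obtain rfl : E' = E - lapply G f := by rw [← hf, sub_sub_cancel]
  let F : ℤ → V → ℤ := fun t => E - lapply G fun v => max (f v) t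
  let L : ℤ → Finset V := fun t => {v | f v ≤ t}
  have hF : ∀ t, Effective (F t) := effective_sub_lapply_max hE hE'
  have hDF : ∀ t, LinEquiv G D (F t) := fun t => hDE.sub_lapply _
  have hfire : ∀ t, F (t + 1) - F t = lapply G fun w => if w ∈ (L t)ᶜ then 1 else 0 :=
    lapply_max_sub_lapply_max f
  have hfire' : ∀ t, F t - F (t + 1) = lapply G fun w => if w ∈ L t then 1 else 0 := fun t => by
    rw [← neg_sub, hfire, ← zero_sub, ← lapply_const G 1, ← lapply_sub]
    congr 1
    ext w
    by_cases hw : w ∈ L t <;> simp [hw]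
  obtain ⟨M, hM⟩ : ∃ M, ∀ v, f v ≤ M := (Set.finite_range f).bddAbove.imp fun M h v => h ⟨v, rfl⟩
  obtain ⟨m, hm⟩ : ∃ m, ∀ v, m ≤ f v := (Set.finite_range f).bddBelow.imp fun m h v => h ⟨v, rfl⟩
  have hFM : ∀ t, M ≤ t → F t = E := fun t ht => by
    have : (fun v => max (f v) t) = fun _ => t :=
      funext fun v => max_eq_right ((hM v).trans ht)
    simp only [F, this, lapply_const, sub_zero]
  have hFm : ∀ t, t ≤ m → F t = E - lapply G f := fun t ht => by
    have : (fun v => max (f v) t) = f := funext fun v => max_eq_left (ht.trans (hm v))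
    simp only [F, this]
  obtain ⟨s, hs, hleast⟩ := Int.exists_least_of_bdd (P := fun t => (#(L t)ᶜ : ℝ) ≤ c)
    ⟨m, fun t ht => by
      by_contra! hlt
      have hLt : L t = ∅ := by
        ext v
        have := hm v
        simp only [L, Finset.mem_filter, Finset.mem_univ, true_and, Finset.notMem_empty, iff_false]
        lia
      rw [hLt, Finset.compl_empty] at ht
      have : (#C : ℝ) ≤ #(Finset.univ : Finset V) := by
        exact_mod_cast Finset.card_le_card (Finset.subset_univ C)
      linarith [hC.1]⟩
    ⟨M, by
      have hLM : L M = Finset.univ := by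
        ext v
        simp [L, hM v]
      simpa [hLM] using hc⟩
  have hup : ∀ t, s ≤ t → missed (F s) ⊆ missed (F t) := fun t ht => by
    induction t, ht using Int.leInduction with
    | base => exact subset_rfl
    | succ t ht ih =>
      have hsmall : (#(L t)ᶜ : ℝ) ≤ c := by
        refine le_trans ?_ hs
        exact_mod_cast Finset.card_le_card (Finset.compl_subset_compl.2 fun v hv => by
          simp only [L, Finset.mem_filter, Finset.mem_univ, true_and] at hv ⊢
          exact hv.trans ht)
      exact fun A hA => ⟨hA.1, (ih hA).1.eq_zero_of_fire (hF _) (hfire' t) hsmall (ih hA).2⟩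
  have hdown : ∀ t, t ≤ s → missed (F s) ⊆ missed (F t) := fun t ht => by
    induction t, ht using Int.leInductionDown with
    | base => exact subset_rfl
    | pred t ht ih =>
      have hlarge : c < #(L (t - 1))ᶜ := by
        by_contra! hle
        have := hleast _ hle
        lia
      have hsmall : (#(L (t - 1))ᶜᶜ : ℝ) ≤ c := by
        by_contra! hlt
        have h1 := hcut _ hlarge hlt
        have h2 := card_interedges_le_degD (hF _) (hF _) (hfire (t - 1))
        rw [← (hDF _).degD_eq] at h2
        lia
      have hstep := hfire (t - 1)
      rw [sub_add_cancel] at hstep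
      exact fun A hA => ⟨hA.1, (ih hA).1.eq_zero_of_fire (hF _) hstep hsmall (ih hA).2⟩
  have hsE : missed (F s) ⊆ missed E := by
    have := hup (max s M) (le_max_left _ _)
    rwa [hFM _ (le_max_right _ _)] at this
  have hEE' : missed E ⊆ missed (E - lapply G f) := by
    have := hdown (min s m) (min_le_left _ _)
    rw [hFm _ (min_le_right _ _)] at this
    exact (hmin _ ⟨hF s, hDF s⟩ hsE).trans this
  exact hvE' ((hEE' ⟨hC, hC0⟩).2 v hv)

theorem posRank_one (G : SimpleGraph V) [DecidableRel G.Adj] : PosRank G fun _ => 1 := by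
  refine fun v => ⟨fun w => 1 - if w = v then 1 else 0, fun w => ?_, 0, ?_⟩
  · by_cases h : w = v <;> simp [h]
  · rw [sub_self]
    exact (lapply_const G 0).symm

theorem le_gonality {r : ℝ} (h : ∀ D, PosRank G D → r ≤ degD D) : r ≤ gonality G := by
  refine Int.ceil_le.1 (le_csInf ⟨_, _, posRank_one G, rfl⟩ ?_)
  rintro d ⟨D, hD, rfl⟩
  exact Int.ceil_le.2 (h D hD)

end PositiveRank

/-- Theorem 2 (random 3-regular graphs): if `G` is a 3-regular finite connected simple
graph with `h(G) ≥ 1/4.95` and `h_{0.36}(G) ≥ 0.24`, then `gon(G) ≥ 0.072 |V(G)|`. -/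
theorem gonality_ge_of_three_regular_expander {V : Type*} [Fintype V] [DecidableEq V]
    (G : SimpleGraph V) [DecidableRel G.Adj] (hG : G.Connected)
    (hreg : G.IsRegularOfDegree 3)
    (hh : (1 / 4.95 : ℝ) ≤ cheeger G) (hhu : (0.24 : ℝ) ≤ cheegerU G 0.36) :
    (0.072 : ℝ) * (Fintype.card V : ℝ) ≤ (gonality G : ℝ) := by
  have : Nonempty V := hG.nonempty
  have hn : (0 : ℝ) < Fintype.card V := by exact_mod_cast Fintype.card_pos
  refine le_gonality fun D hD => ?_
  by_contra! hlt
  have hcut : ∀ A : Finset V, 0.36 * (Fintype.card V : ℝ) < #A →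
      0.36 * (Fintype.card V : ℝ) < #Aᶜ → degD D < #(G.interedges A Aᶜ) := fun A hA hA' => by
    have := le_card_interedges_of_le_cheeger G hh (by norm_num) (by positivity) hA hA'
    have : (degD D : ℝ) < #(G.interedges A Aᶜ) := by
      norm_num at this hlt
      linarith
    exact_mod_cast this
  obtain ⟨E, hE, hDE, hhit⟩ := hD.exists_effective_hitting (by positivity) hcut
  obtain ⟨C, hC, hC0⟩ := exists_isCluster_eq_zero G hreg
    (fun U => le_card_interedges_of_le_cheegerU G hhu) (by norm_num) hE (by
      rw [← hDE.degD_eq]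
      norm_num at hlt ⊢
      linarith)
  obtain ⟨v, hv, hv0⟩ := hhit C hC
  exact hv0 (hC0 v hv)

end GraphGonality
end
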